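/- arXiv:1804.10895 — 2 statements merged into one kernel-verified Lean document; each statement's English description precedes it below -/
import Mathlib

section
/- Let K be a commutative ring that is a ℚ-algebra, let n ≥ 1, let A = (a_{ij}) be an n×n matrix over K, and let γ_1,…,γ_n ∈ K be arbitrary. Then per(A) = ∏_{i=1}^n γ_i + Σ_{k=1}^n (−1)^k Σ_{1 ≤ j_1 < ⋯ < j_k ≤ n} ∏_{i=1}^n (γ_i − a_{i j_1} − ⋯ − a_{i j_k}); equivalently, per(A) = Σ_{S ⊆ {1,…,n}} (−1)^{|S|} ∏_{i=1}^n (γ_i − Σ_{j∈S} a_{ij}), the sum over all subsets S of {1,…,n}. -/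
/-- The permanent of a square matrix: `per A = ∑_{σ ∈ S_n} ∏ i, a_{i σ(i)}`. -/
def perm' {K : Type*} [CommRing K] {n : ℕ} (A : Matrix (Fin n) (Fin n) K) : K :=
  ∑ σ : Equiv.Perm (Fin n), ∏ i, A i (σ i)

open Finset in
/-- The alternating sum over the supersets of `T` vanishes unless `T` is everything. -/
theorem sum_neg_one_pow_card_superset {ι K : Type*} [Fintype ι] [DecidableEq ι] [CommRing K]
    (T : Finset ι) :
    ∑ S : Finset ι, (-1 : K) ^ #S * (if T ⊆ S then 1 else 0) =
      if T = univ then (-1) ^ Fintype.card ι else 0 := by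
  have h := prod_add (fun _ : ι => (-1 : K)) (fun j => if j ∈ T then 0 else 1) univ
  rw [powerset_univ] at h
  have expand : ∀ S : Finset ι, (∏ _j ∈ S, (-1 : K)) * ∏ j ∈ univ \ S, (if j ∈ T then 0 else 1) =
      (-1 : K) ^ #S * (if T ⊆ S then 1 else 0) := by
    intro S
    rw [prod_const]
    congr 1
    split_ifs with hS
    · refine prod_eq_one fun j hj => if_neg fun hT => ?_
      exact (mem_sdiff.1 hj).2 (hS hT)
    · obtain ⟨j, hT, hj⟩ := not_subset.1 hS
      exact prod_eq_zero (i := j) (by simp [hj]) (if_pos hT)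
  simp_rw [expand] at h
  rw [← h]
  split_ifs with hT
  · simp [hT]
  · obtain ⟨j, hj⟩ : ∃ j, j ∉ T := by simpa [eq_univ_iff_forall] using hT
    exact prod_eq_zero (mem_univ j) (by simp [hj])

/-- A map `ι → Option ι` on a finite type that hits every `some j` is `some ∘ σ` for a
permutation `σ`. -/
theorem exists_perm_of_forall_exists_eq_some {ι : Type*} [Finite ι] (f : ι → Option ι)
    (hf : ∀ j, ∃ i, f i = some j) : ∃ σ : Equiv.Perm ι, ∀ i, f i = some (σ i) := by
  choose g hg using hf
  have hinj : Function.Injective g := fun a b hab =>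
    Option.some_injective _ (by rw [← hg a, ← hg b, hab])
  let e : Equiv.Perm ι := Equiv.ofBijective g (Finite.injective_iff_bijective.1 hinj)
  refine ⟨e.symm, fun i => ?_⟩
  have h := hg (e.symm i)
  rwa [show g (e.symm i) = i from e.apply_symm_apply i] at h

open Finset in
/-- Expansion of `∏ i, (γ i - ∑ j ∈ S, A i j)` over choices of one summand from each factor,
where `none` selects `γ i` and `some j` selects `-A i j`. -/
theorem prod_sub_sum_eq_sum_option {ι K : Type*} [Fintype ι] [DecidableEq ι] [CommRing K]
    (A : Matrix ι ι K) (γ : ι → K) (S : Finset ι) :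
    ∏ i, (γ i - ∑ j ∈ S, A i j) =
      ∑ f : ι → Option ι, (∏ i, (f i).elim (γ i) (fun j => -A i j)) *
        (if univ.filter (fun j => ∃ i, f i = some j) ⊆ S then 1 else 0) := by
  have factor : ∀ i, γ i - ∑ j ∈ S, A i j =
      ∑ o : Option ι, o.elim (γ i) (fun j => if j ∈ S then -A i j else 0) := by
    intro i
    simp [Fintype.sum_option, sub_eq_add_neg]
  simp_rw [factor, Fintype.prod_sum]
  refine sum_congr rfl fun f _ => ?_
  split_ifs with hS
  · rw [mul_one]
    refine prod_congr rfl fun i _ => ?_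
    cases hfi : f i with
    | none => rfl
    | some j => exact if_pos (hS (by simpa using ⟨i, hfi⟩))
  · obtain ⟨j, hj, hjS⟩ := not_subset.1 hS
    obtain ⟨i, hi⟩ : ∃ i, f i = some j := by simpa using hj
    rw [mul_zero]
    exact prod_eq_zero (mem_univ i) (by simp [hi, hjS])

/-- **The first polynomial identity for permanents (Egorychev, 1979).**
`per A = ∑_{S ⊆ {1,…,n}} (−1)^{|S|} ∏_{i=1}^n (γ_i − ∑_{j∈S} a_{ij})`. -/
theorem per_polynomial_identity
    {K : Type*} [CommRing K] [Algebra ℚ K]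
    (n : ℕ) (hn : 1 ≤ n)
    (A : Matrix (Fin n) (Fin n) K) (γ : Fin n → K) :
    perm' A =
      ∑ S : Finset (Fin n),
        (-1 : K) ^ S.card * ∏ i, (γ i - ∑ j ∈ S, A i j) := by
  simp_rw [prod_sub_sum_eq_sum_option, Finset.mul_sum, mul_left_comm ((-1 : K) ^ _)]
  rw [Finset.sum_comm]
  simp_rw [← Finset.mul_sum, sum_neg_one_pow_card_superset, Fintype.card_fin]
  unfold perm'
  refine Finset.sum_of_injOn (fun σ i => some (σ i)) ?_ (by simp) ?_ ?_
  · intro σ _ τ _ h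
    exact Equiv.ext fun i => Option.some_injective _ (congrFun h i)
  · intro f _ hf
    rw [if_neg, mul_zero]
    intro hT
    obtain ⟨σ, hσ⟩ := exists_perm_of_forall_exists_eq_some f
      (by simpa [Finset.eq_univ_iff_forall] using hT)
    exact hf ⟨σ, by simp, funext fun i => (hσ i).symm⟩
  · intro σ _
    rw [if_pos]
    · simp [Finset.prod_neg, mul_right_comm, ← mul_pow]
    · ext j
      simp
end

section
/- Let R be a (possibly noncommutative) associative ring that is a ℚ-algebra, let n ≥ 1, and let A = (a_{ij}) be an n×n matrix over R. Then eper(A) = 0 if and only if Σ_{∅ ≠ Rw ⊆ {1,…,n}} Σ_{∅ ≠ Cl ⊆ {1,…,n}} (−1)^{|Rw|+|Cl|} (Σ_{i∈Rw} Σ_{j∈Cl} a_{ij})^n = 0, where Rw ranges over all nonempty subsets of row indices and Cl over all nonempty subsets of column indices. -/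
/-- The symmetrized permanent over a noncommutative ring `R` which is a `ℚ`-algebra:
`eper A := ∑_{σ ∈ S_n} Sym(a_{1σ(1)} ⋯ a_{nσ(n)})`, where
`Sym(x_1 ⋯ x_n) := (1/n!) ∑_{τ ∈ S_n} x_{τ(1)} ⋯ x_{τ(n)}` (ordered products). -/
def eper {R : Type*} [Ring R] [Algebra ℚ R] {n : ℕ}
    (A : Matrix (Fin n) (Fin n) R) : R :=
  ∑ σ : Equiv.Perm (Fin n),
    (n.factorial : ℚ)⁻¹ •
      ∑ τ : Equiv.Perm (Fin n), (List.ofFn fun k => A (τ k) (σ (τ k))).prod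

/-- The alternating sum over all finsets containing `T` detects whether `T` is everything. -/
theorem sum_superset_neg_one_pow_card {ι R : Type*} [Fintype ι] [DecidableEq ι] [Ring R]
    (T : Finset ι) :
    ∑ S : Finset ι, (if T ⊆ S then (-1 : R) ^ S.card else 0) =
      if T = Finset.univ then (-1 : R) ^ Fintype.card ι else 0 := by
  have hcompl : ∀ S : Finset ι,
      (-1 : R) ^ Sᶜ.card = (-1) ^ Fintype.card ι * (-1) ^ S.card := by
    intro S
    rw [← Finset.card_add_card_compl S, pow_add, (Commute.refl (-1 : R)).pow_pow _ _ |>.eq,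
      mul_assoc, ← pow_add, Even.neg_one_pow ⟨_, rfl⟩, mul_one]
  have hpow : ∑ S ∈ Tᶜ.powerset, (-1 : R) ^ S.card = if Tᶜ = ∅ then 1 else 0 := by
    have h := congrArg (Int.cast : ℤ → R) (Finset.sum_powerset_neg_one_pow_card (x := Tᶜ))
    push_cast at h
    exact h
  rw [← Equiv.sum_comp (Function.Involutive.toPerm compl (compl_involutive (α := Finset ι)))]
  calc ∑ S : Finset ι, (if T ⊆ Sᶜ then (-1 : R) ^ Sᶜ.card else 0)
      = ∑ S ∈ Tᶜ.powerset, (-1 : R) ^ Fintype.card ι * (-1) ^ S.card := by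
        rw [← Finset.sum_filter]
        refine Finset.sum_congr ?_ fun S _ => hcompl S
        ext S
        simp [Finset.subset_compl_comm]
    _ = _ := by
        rw [← Finset.mul_sum, hpow]
        simp [Finset.compl_eq_empty_iff]

/-- Inclusion–exclusion over the possible ranges of a self-map singles out the permutations. -/
theorem sum_neg_one_pow_card_mul_sum_piFinset {ι R : Type*} [Fintype ι] [DecidableEq ι] [Ring R]
    (G : (ι → ι) → R) :
    ∑ S : Finset ι, (-1 : R) ^ S.card * ∑ f ∈ Fintype.piFinset fun _ : ι => S, G f =
      (-1) ^ Fintype.card ι * ∑ σ : Equiv.Perm ι, G σ := by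
  have hmem : ∀ (S : Finset ι) (f : ι → ι),
      f ∈ Fintype.piFinset (fun _ : ι => S) ↔ Finset.univ.image f ⊆ S := by
    intro S f
    simp [Fintype.mem_piFinset, Finset.image_subset_iff]
  have hperm : ∑ f : ι → ι with Finset.univ.image f = Finset.univ, G f =
      ∑ σ : Equiv.Perm ι, G σ := by
    refine (Finset.sum_bij (fun (σ : Equiv.Perm ι) _ => (σ : ι → ι)) ?_ ?_ ?_ ?_).symm
    · intro σ _
      simp [Finset.image_univ_of_surjective σ.surjective]
    · intro σ _ τ _ h
      exact DFunLike.coe_injective h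
    · intro f hf
      have hsurj : Function.Surjective f :=
        by
        simpa [Finset.eq_univ_iff_forall, Function.Surjective] using hf
      exact ⟨Equiv.ofBijective f (Finite.surjective_iff_bijective.mp hsurj),
        Finset.mem_univ _, rfl⟩
    · intro σ _
      rfl
  calc ∑ S : Finset ι, (-1 : R) ^ S.card * ∑ f ∈ Fintype.piFinset fun _ : ι => S, G f
      = ∑ S : Finset ι, ∑ f : ι → ι,
          (if Finset.univ.image f ⊆ S then (-1 : R) ^ S.card else 0) * G f := by
        refine Finset.sum_congr rfl fun S _ => ?_
        simp only [ite_mul, zero_mul, ← Finset.sum_filter, ← hmem, Finset.mul_sum]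
        exact Finset.sum_congr (by ext f; simp) fun _ _ => rfl
    _ = ∑ f : ι → ι,
          (if Finset.univ.image f = Finset.univ then (-1 : R) ^ Fintype.card ι else 0) * G f := by
        rw [Finset.sum_comm]
        simp only [← Finset.sum_mul, sum_superset_neg_one_pow_card]
    _ = _ := by
        simp only [ite_mul, zero_mul, ← Finset.sum_filter, ← Finset.mul_sum, hperm]

/-- Expansion of a power of a double sum in a noncommutative ring. -/
theorem sum_sum_pow_eq_sum_piFinset {ι κ R : Type*} [DecidableEq ι] [DecidableEq κ] [Ring R]
    (n : ℕ) (A : Matrix ι κ R) (s : Finset ι) (t : Finset κ) :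
    (∑ i ∈ s, ∑ j ∈ t, A i j) ^ n =
      ∑ f ∈ Fintype.piFinset fun _ : Fin n => s, ∑ g ∈ Fintype.piFinset fun _ : Fin n => t,
        (List.ofFn fun k => A (f k) (g k)).prod := by
  rw [← MultilinearMap.mkPiAlgebraFin_apply_const (R := ℤ), MultilinearMap.map_sum_finset]
  refine Finset.sum_congr rfl fun f _ => ?_
  rw [MultilinearMap.map_sum_finset]
  simp only [MultilinearMap.mkPiAlgebraFin_apply]

/-- The alternating sum over all submatrices is `n!` times the symmetrized permanent. -/
theorem sum_sum_neg_one_pow_mul_pow_eq_factorial_smul_eper {R : Type*} [Ring R] [Algebra ℚ R]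
    {n : ℕ} (A : Matrix (Fin n) (Fin n) R) :
    ∑ Rw : Finset (Fin n), ∑ Cl : Finset (Fin n),
        (-1 : R) ^ (Rw.card + Cl.card) * (∑ i ∈ Rw, ∑ j ∈ Cl, A i j) ^ n =
      (n.factorial : ℚ) • eper A := by
  calc _ = ∑ Rw : Finset (Fin n), (-1 : R) ^ Rw.card *
          ∑ f ∈ Fintype.piFinset fun _ : Fin n => Rw,
            ∑ Cl : Finset (Fin n), (-1 : R) ^ Cl.card *
              ∑ g ∈ Fintype.piFinset fun _ : Fin n => Cl,
                (List.ofFn fun k => A (f k) (g k)).prod := by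
        refine Finset.sum_congr rfl fun Rw _ => ?_
        rw [Finset.sum_comm, Finset.mul_sum]
        refine Finset.sum_congr rfl fun Cl _ => ?_
        rw [sum_sum_pow_eq_sum_piFinset, pow_add, mul_assoc, ← Finset.mul_sum]
    _ = ∑ τ : Equiv.Perm (Fin n), ∑ ρ : Equiv.Perm (Fin n),
          (List.ofFn fun k => A (τ k) (ρ k)).prod := by
        simp only [sum_neg_one_pow_card_mul_sum_piFinset]
        rw [← Finset.mul_sum]
        rw [← mul_assoc, ← pow_add, Even.neg_one_pow ⟨_, rfl⟩, one_mul]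
    _ = ∑ τ : Equiv.Perm (Fin n), ∑ σ : Equiv.Perm (Fin n),
          (List.ofFn fun k => A (τ k) (σ (τ k))).prod := by
        refine Finset.sum_congr rfl fun τ _ => ?_
        rw [← Equiv.sum_comp (Equiv.mulRight τ)]
        rfl
    _ = _ := by
        rw [eper, ← Finset.smul_sum, smul_inv_smul₀ (by exact_mod_cast n.factorial_ne_zero),
          Finset.sum_comm]

/-- **Corollary 2, second part (Egorychev).**  `eper A = 0` iff
`∑_{∅≠Rw} ∑_{∅≠Cl} (−1)^{|Rw|+|Cl|} (∑_{i∈Rw} ∑_{j∈Cl} a_{ij})^n = 0`. -/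
theorem eper_eq_zero_iff
    {R : Type*} [Ring R] [Algebra ℚ R]
    (n : ℕ) (hn : 1 ≤ n)
    (A : Matrix (Fin n) (Fin n) R) :
    eper A = 0 ↔
      (∑ Rw ∈ Finset.univ.filter (fun S : Finset (Fin n) => S ≠ ∅),
        ∑ Cl ∈ Finset.univ.filter (fun S : Finset (Fin n) => S ≠ ∅),
          (-1 : R) ^ (Rw.card + Cl.card) *
            (∑ i ∈ Rw, ∑ j ∈ Cl, A i j) ^ n) = 0 := by
  have hn0 : n ≠ 0 := Nat.one_le_iff_ne_zero.mp hn
  have hdrop : ∀ F : Finset (Fin n) → R, F ∅ = 0 →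
      ∑ S ∈ Finset.univ.filter (fun S : Finset (Fin n) => S ≠ ∅), F S = ∑ S, F S := by
    intro F hF
    refine Finset.sum_filter_of_ne fun S _ hS h => hS ?_
    rw [h, hF]
  rw [hdrop _ (by simp [hn0])]
  have hcol : ∀ Rw : Finset (Fin n), _ := fun Rw =>
    hdrop (fun Cl => (-1 : R) ^ (Rw.card + Cl.card) * (∑ i ∈ Rw, ∑ j ∈ Cl, A i j) ^ n)
      (by simp [hn0])
  simp only [hcol]
  rw [sum_sum_neg_one_pow_mul_pow_eq_factorial_smul_eper,
    smul_eq_zero_iff_right (by exact_mod_cast n.factorial_ne_zero)]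
end
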